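/- For every a ∈ ℂ³, s((a₀y₀ + a₁y₁ + a₂y₂)⁶) = 120·(ν(a)₀x₀ + ν(a)₁x₁ + ν(a)₂x₂ + ν(a)₃x₃ + ν(a)₄x₄ + ν(a)₅x₅)³. In invariant terms: s(a⁶) equals the cube (a²)³ of the square of a, up to the fixed nonzero scalar 120 which is independent of a. (Formula (1.4) of the paper, s(a⁶) = (a²)³.) -/

import Mathlib

open MvPolynomial

/-- The constant-coefficient differential operator associated with the monomial
exponent `d`: the composition over `i` of `(∂/∂xᵢ)^(d i)`. -/
noncomputable def monOp {n : ℕ} (d : Fin n →₀ ℕ) :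
    Module.End ℂ (MvPolynomial (Fin n) ℂ) :=
  (List.ofFn fun i : Fin n =>
    ((pderiv (R := ℂ) i).toLinearMap : Module.End ℂ (MvPolynomial (Fin n) ℂ)) ^ (d i)).prod

/-- The apolarity action `g ∘ f` : apply `g`, viewed as a constant-coefficient
differential operator, to `f`. -/
noncomputable def apolar {n : ℕ} (g f : MvPolynomial (Fin n) ℂ) :
    MvPolynomial (Fin n) ℂ :=
  ∑ d ∈ g.support, coeff d g • monOp d f

/-- The apolarity pairing `⟨f, k⟩ := k ∘ f` (its constant term). -/
noncomputable def pairing {n : ℕ} (f k : MvPolynomial (Fin n) ℂ) : ℂ :=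
  eval (fun _ => (0 : ℂ)) (apolar k f)

/-- The linear form `Σ vᵢ xᵢ` associated with a vector `v`. -/
noncomputable def linForm {n : ℕ} (v : Fin n → ℂ) : MvPolynomial (Fin n) ℂ :=
  ∑ i, MvPolynomial.C (v i) * X i

/-- The directional partial derivative `∂_v f = Σ vᵢ ∂f/∂xᵢ`. -/
noncomputable def pdir {n : ℕ} (v : Fin n → ℂ) (f : MvPolynomial (Fin n) ℂ) :
    MvPolynomial (Fin n) ℂ :=
  ∑ i, MvPolynomial.C (v i) * pderiv i f

/-- The Veronese map `ν : ℂ³ → ℂ⁶`. -/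
noncomputable def nu (w : Fin 3 → ℂ) : Fin 6 → ℂ :=
  ![w 0 ^ 2, 2 * w 0 * w 1, 2 * w 0 * w 2, w 1 ^ 2, 2 * w 1 * w 2, w 2 ^ 2]

/-- The components of the Veronese map as quadratic forms in `y₀, y₁, y₂`. -/
noncomputable def nuPoly : Fin 6 → MvPolynomial (Fin 3) ℂ :=
  ![X 0 ^ 2, 2 * X 0 * X 1, 2 * X 0 * X 2, X 1 ^ 2, 2 * X 1 * X 2, X 2 ^ 2]

/-- A quadratic form `q` in 6 variables has rank `≤ r`: there is a symmetric matrix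
`M` of rank `≤ r` with `q(x) = xᵀ M x`. -/
def QuadRankLe (q : MvPolynomial (Fin 6) ℂ) (r : ℕ) : Prop :=
  ∃ M : Matrix (Fin 6) (Fin 6) ℂ, M.IsSymm ∧ M.rank ≤ r ∧
    ∀ x : Fin 6 → ℂ, eval x q = ∑ i, ∑ j, M i j * x i * x j

/-- `s` is the linear map carrying a ternary sextic `g` to the cubic `s(g)` in six
variables, characterized by `⟨s(g), k⟩ = ⟨g, m(k)⟩` for all cubic forms `k`, where
`m(k) = k ∘ ν`. -/
def IsSMap (s : MvPolynomial (Fin 3) ℂ →ₗ[ℂ] MvPolynomial (Fin 6) ℂ) : Prop :=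
  (∀ g : MvPolynomial (Fin 3) ℂ, g.IsHomogeneous 6 → (s g).IsHomogeneous 3) ∧
  ∀ g : MvPolynomial (Fin 3) ℂ, ∀ k : MvPolynomial (Fin 6) ℂ,
    g.IsHomogeneous 6 → k.IsHomogeneous 3 →
      pairing (s g) k = pairing g (aeval nuPoly k)

/-- Evaluation of a polynomial function `P` in the coefficients at a polynomial `g`. -/
noncomputable def evalCoeff {σ : Type} (g : MvPolynomial σ ℂ) (P : MvPolynomial (σ →₀ ℕ) ℂ) : ℂ :=
  eval (fun d => coeff d g) P

/-- The vanishing ideal of a subset of `ℂ⁵⁶`. -/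
noncomputable def vanishingIdealOf (S : Set (Fin 56 → ℂ)) : Ideal (MvPolynomial (Fin 56) ℂ) :=
  ⨅ x ∈ S, RingHom.ker (eval x)

/-- An ideal is a prime ideal of height one: it is prime, admits a prime strictly
below it, and admits no chain of two primes strictly below it. -/
def IsHeightOnePrime {R : Type*} [CommRing R] (I : Ideal R) : Prop :=
  I.IsPrime ∧ (∃ p : Ideal R, p.IsPrime ∧ p < I) ∧
    ∀ p q : Ideal R, p.IsPrime → q.IsPrime → p < q → ¬ q < I

/-- The space `Q_{f,U}` of quadratic forms vanishing on `U` and apolar to `f`. -/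
def QfU (f : MvPolynomial (Fin 6) ℂ) (U : Submodule ℂ (Fin 6 → ℂ)) :
    Set (MvPolynomial (Fin 6) ℂ) :=
  {q | q.IsHomogeneous 2 ∧ (∀ u ∈ U, eval u q = 0) ∧ apolar q f = 0}

/-- The Zariski closure of a subset of `ℂ⁵⁶`. -/
def zcl (S : Set (Fin 56 → ℂ)) : Set (Fin 56 → ℂ) :=
  {x | ∀ P : MvPolynomial (Fin 56) ℂ, (∀ y ∈ S, eval y P = 0) → eval x P = 0}

/-- The projection of a polynomial onto its squarefree monomials. -/
noncomputable def sqfreeProj (f : MvPolynomial (Fin 6) ℂ) : MvPolynomial (Fin 6) ℂ :=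
  ∑ d ∈ f.support.filter (fun d => ∀ i, d i ≤ 1), monomial d (coeff d f)


/-- The linear form of `v` is homogeneous of degree one. -/
lemma linForm_isHomogeneous {n : ℕ} (v : Fin n → ℂ) : (linForm v).IsHomogeneous 1 :=
  IsHomogeneous.sum _ _ _ fun i _ => isHomogeneous_C_mul_X (v i) i

lemma pderiv_linForm {n : ℕ} (v : Fin n → ℂ) (i : Fin n) :
    pderiv i (linForm v) = C (v i) := by
  simp [linForm, pderiv_X, Pi.single_apply]

lemma pderiv_pow_linForm_pow {n : ℕ} (v : Fin n → ℂ) (i : Fin n) (k m : ℕ) :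
    (((pderiv (R := ℂ) i).toLinearMap : Module.End ℂ (MvPolynomial (Fin n) ℂ)) ^ k)
        (linForm v ^ (m + k)) =
      (((m + k).factorial : ℂ) / (m.factorial : ℂ) * v i ^ k) • linForm v ^ m := by
  induction k with
  | zero => simp [Nat.factorial_ne_zero]
  | succ k ih =>
    have hstep : pderiv i (linForm v ^ (m + (k + 1))) =
        (((m + k + 1 : ℕ) : ℂ) * v i) • linForm v ^ (m + k) := by
      rw [pderiv_pow, pderiv_linForm, smul_eq_C_mul, ← add_assoc, Nat.add_sub_cancel, C_mul,
        map_natCast]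
      ring
    rw [pow_succ, Module.End.mul_apply, Derivation.coeFn_coe, hstep, map_smul, ih, smul_smul,
      ← add_assoc, Nat.factorial_succ]
    congr 1
    push_cast
    ring

lemma list_prod_pderiv_linForm_pow {n : ℕ} (v : Fin n → ℂ) (d : Fin n → ℕ)
    (l : List (Fin n)) (m : ℕ) :
    (l.map fun i => ((pderiv (R := ℂ) i).toLinearMap :
        Module.End ℂ (MvPolynomial (Fin n) ℂ)) ^ d i).prod (linForm v ^ (m + (l.map d).sum)) =
      (((m + (l.map d).sum).factorial : ℂ) / (m.factorial : ℂ) *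
        (l.map fun i => v i ^ d i).prod) • linForm v ^ m := by
  induction l generalizing m with
  | nil => simp [Nat.factorial_ne_zero]
  | cons i l ih =>
    have hm : ((m + d i).factorial : ℂ) ≠ 0 := Nat.cast_ne_zero.mpr (Nat.factorial_ne_zero _)
    simp only [List.map_cons, List.prod_cons, List.sum_cons, Module.End.mul_apply, ← add_assoc]
    rw [ih, map_smul, pderiv_pow_linForm_pow, smul_smul]
    congr 1
    field_simp

lemma monOp_linForm_pow {n : ℕ} (v : Fin n → ℂ) (d : Fin n →₀ ℕ) :
    monOp d (linForm v ^ d.degree) =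
      C ((d.degree.factorial : ℂ) * ∏ i, v i ^ d i) := by
  have h := list_prod_pderiv_linForm_pow v d (List.finRange n) 0
  rw [← List.ofFn_eq_map, ← List.ofFn_eq_map, ← List.ofFn_eq_map, List.sum_ofFn,
    List.prod_ofFn (f := fun i => v i ^ d i), ← Finsupp.degree_eq_sum] at h
  simpa [monOp, smul_eq_C_mul] using h

/-- Pairing with the `N`-th power of a linear form is evaluation, up to `N!`. -/
lemma pairing_linForm_pow {n N : ℕ} (v : Fin n → ℂ) {k : MvPolynomial (Fin n) ℂ}
    (hk : k.IsHomogeneous N) :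
    pairing (linForm v ^ N) k = (N.factorial : ℂ) * eval v k := by
  rw [pairing, apolar, map_sum, eval_eq', Finset.mul_sum]
  refine Finset.sum_congr rfl fun d hd => ?_
  obtain rfl : N = d.degree := hk.degree_eq_sum_deg_support hd
  rw [monOp_linForm_pow, smul_eval, eval_C]
  ring

lemma coeff_pderiv_pow {n : ℕ} (i : Fin n) (k : ℕ) (m : Fin n →₀ ℕ) :
    ∃ c : ℂ, c ≠ 0 ∧ ∀ f : MvPolynomial (Fin n) ℂ,
      coeff m ((((pderiv (R := ℂ) i).toLinearMap :
        Module.End ℂ (MvPolynomial (Fin n) ℂ)) ^ k) f) =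
      c * coeff (m + Finsupp.single i k) f := by
  induction k with
  | zero => exact ⟨1, one_ne_zero, fun f => by simp⟩
  | succ k ih =>
    obtain ⟨c, hc, h⟩ := ih
    refine ⟨c * (((m + Finsupp.single i k) i : ℂ) + 1),
      mul_ne_zero hc (Nat.cast_add_one_ne_zero _), fun f => ?_⟩
    rw [pow_succ, Module.End.mul_apply, h, Derivation.coeFn_coe, coeff_pderiv, add_assoc m,
      ← Finsupp.single_add]
    ring

lemma coeff_list_prod_pderiv {n : ℕ} (d : Fin n → ℕ) (l : List (Fin n)) (m : Fin n →₀ ℕ) :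
    ∃ c : ℂ, c ≠ 0 ∧ ∀ f : MvPolynomial (Fin n) ℂ,
      coeff m ((l.map fun i => ((pderiv (R := ℂ) i).toLinearMap :
        Module.End ℂ (MvPolynomial (Fin n) ℂ)) ^ d i).prod f) =
      c * coeff (m + (l.map fun i => Finsupp.single i (d i)).sum) f := by
  induction l generalizing m with
  | nil => exact ⟨1, one_ne_zero, fun f => by simp⟩
  | cons i l ih =>
    obtain ⟨c, hc, h⟩ := coeff_pderiv_pow i (d i) m
    obtain ⟨c', hc', h'⟩ := ih (m + Finsupp.single i (d i))
    refine ⟨c * c', mul_ne_zero hc hc', fun f => ?_⟩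
    rw [List.map_cons, List.prod_cons, Module.End.mul_apply, h, h', List.map_cons, List.sum_cons,
      add_assoc, mul_assoc]

/-- Pairing with a monomial extracts its coefficient, up to a nonzero scalar. -/
lemma pairing_monomial {n : ℕ} (d : Fin n →₀ ℕ) :
    ∃ c : ℂ, c ≠ 0 ∧ ∀ f : MvPolynomial (Fin n) ℂ,
      pairing f (monomial d 1) = c * coeff d f := by
  obtain ⟨c, hc, h⟩ := coeff_list_prod_pderiv d (List.finRange n) 0
  refine ⟨c, hc, fun f => ?_⟩
  have hf := h f
  rw [← List.ofFn_eq_map, ← List.ofFn_eq_map, List.sum_ofFn, Finsupp.univ_sum_single,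
    zero_add] at hf
  rw [← hf, pairing, apolar, support_monomial, if_neg one_ne_zero, Finset.sum_singleton,
    coeff_monomial, if_pos rfl, one_smul, eval_zero', constantCoeff_eq]
  rfl

/-- The apolarity pairing separates forms of a fixed degree. -/
lemma eq_of_pairing_eq {n N : ℕ} {f g : MvPolynomial (Fin n) ℂ}
    (hf : f.IsHomogeneous N) (hg : g.IsHomogeneous N)
    (h : ∀ k : MvPolynomial (Fin n) ℂ, k.IsHomogeneous N → pairing f k = pairing g k) :
    f = g := by
  ext d
  by_cases hd : d.degree = N
  · obtain ⟨c, hc, hcoeff⟩ := pairing_monomial d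
    have hk := h _ (isHomogeneous_monomial (1 : ℂ) hd)
    rw [hcoeff, hcoeff] at hk
    exact mul_left_cancel₀ hc hk
  · rw [hf.coeff_eq_zero hd, hg.coeff_eq_zero hd]

lemma pairing_smul_left {n : ℕ} (c : ℂ) (f k : MvPolynomial (Fin n) ℂ) :
    pairing (c • f) k = c * pairing f k := by
  simp only [pairing, apolar, map_smul, map_sum, smul_eval, Finset.mul_sum]
  exact Finset.sum_congr rfl fun d _ => by ring

lemma nuPoly_isHomogeneous (i : Fin 6) : (nuPoly i).IsHomogeneous 2 := by
  have hsq (j : Fin 3) : (X j ^ 2 : MvPolynomial (Fin 3) ℂ).IsHomogeneous 2 :=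
    isHomogeneous_X_pow j 2
  have hmul (j l : Fin 3) : (2 * X j * X l : MvPolynomial (Fin 3) ℂ).IsHomogeneous 2 :=
    (isHomogeneous_C_mul_X (2 : ℂ) j).mul (isHomogeneous_X ℂ l)
  fin_cases i
  exacts [hsq 0, hmul 0 1, hmul 0 2, hsq 1, hmul 1 2, hsq 2]

lemma eval_nuPoly (a : Fin 3 → ℂ) (i : Fin 6) : eval a (nuPoly i) = nu a i := by
  fin_cases i <;> simp [nuPoly, nu]

lemma eval_aeval_nuPoly (a : Fin 3 → ℂ) (k : MvPolynomial (Fin 6) ℂ) :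
    eval a (aeval nuPoly k) = eval (nu a) k := by
  induction k using MvPolynomial.induction_on with
  | C c => simp
  | add p q hp hq => rw [map_add, map_add, map_add, hp, hq]
  | mul_X p i hp => rw [map_mul, map_mul, map_mul, hp, aeval_X, eval_nuPoly, eval_X]

/-- **Formula (1.4).** `s(ℓ_a⁶) = 120 · (ν(a)·x)³` for every `a ∈ ℂ³`. -/
theorem statement2 (s : MvPolynomial (Fin 3) ℂ →ₗ[ℂ] MvPolynomial (Fin 6) ℂ)
    (hs : IsSMap s) (a : Fin 3 → ℂ) :
    s (linForm a ^ 6) = (120 : ℂ) • (linForm (nu a) ^ 3) := by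
  have hL : (linForm a ^ 6).IsHomogeneous 6 := (linForm_isHomogeneous a).pow 6
  have hM : (linForm (nu a) ^ 3).IsHomogeneous 3 := (linForm_isHomogeneous (nu a)).pow 3
  refine eq_of_pairing_eq (hs.1 _ hL) (by rw [smul_eq_C_mul]; exact hM.C_mul 120) fun k hk => ?_
  have hmk : (aeval nuPoly k).IsHomogeneous 6 := hk.aeval nuPoly nuPoly_isHomogeneous
  rw [hs.2 _ _ hL hk, pairing_linForm_pow a hmk, pairing_smul_left, pairing_linForm_pow _ hk,
    eval_aeval_nuPoly, ← mul_assoc]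
  norm_num [Nat.factorial]
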